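/- If π = (5^4, 4^{n−4}) (four terms equal to 5 followed by n−4 terms equal to 4), where n ≥ 6 and σ(π) is even, then π is potentially K6−C5-graphic. -/

import Mathlib

/-- The degree of vertex `i` in the simple graph `G`. -/
noncomputable def degCount {n : ℕ} (G : SimpleGraph (Fin n)) (i : Fin n) : ℕ :=
  {j | G.Adj i j}.ncard

/-- The graph `K₆ − C₅`: the complete graph on 6 vertices minus the edges of a
cycle on 5 of its vertices.  Vertex `0` is adjacent to all other vertices, and the
vertices `1,…,5` carry the complement of a 5-cycle (which is again a 5-cycle).
Its degree sequence is `(5,3,3,3,3,3)`. -/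
def K6C5 : SimpleGraph (Fin 6) :=
  SimpleGraph.fromRel (fun a b =>
    a = 0 ∨ b = 0 ∨
      (a, b) ∈ ([(1, 3), (3, 5), (5, 2), (2, 4), (4, 1)] : List (Fin 6 × Fin 6)))

/-- A list of natural numbers is graphic if it is the degree sequence of some
simple graph. -/
def IsGraphic (l : List ℕ) : Prop :=
  ∃ G : SimpleGraph (Fin l.length), ∀ i : Fin l.length, degCount G i = l.get i

/-- A list of natural numbers is potentially `K₆ − C₅`-graphic if it has a
realization containing `K₆ − C₅` as a subgraph. -/
def PotentiallyK6C5 (l : List ℕ) : Prop :=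
  ∃ G : SimpleGraph (Fin l.length),
    (∀ i : Fin l.length, degCount G i = l.get i) ∧
    ∃ f : Fin 6 → Fin l.length, Function.Injective f ∧
      ∀ a b : Fin 6, K6C5.Adj a b → G.Adj (f a) (f b)

namespace SimpleGraph

variable {V : Type*}

/-- Delete the edges `ab` and `cd` of `G` and join the vertex `v` to `a`, `b`, `c` and `d`. -/
def pinch (G : SimpleGraph V) (v a b c d : V) : SimpleGraph V :=
  G.deleteEdges {s(a, b), s(c, d)} ⊔
    fromRel (fun x y => x = v ∧ (y = a ∨ y = b ∨ y = c ∨ y = d))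

theorem pinch_adj {G : SimpleGraph V} {v a b c d x y : V} :
    (G.pinch v a b c d).Adj x y ↔
      (G.Adj x y ∧ s(x, y) ≠ s(a, b) ∧ s(x, y) ≠ s(c, d)) ∨
      (x ≠ y ∧ ((x = v ∧ (y = a ∨ y = b ∨ y = c ∨ y = d)) ∨
        (y = v ∧ (x = a ∨ x = b ∨ x = c ∨ x = d)))) := by
  simp [pinch]

theorem pinch_swap_left (G : SimpleGraph V) (v a b c d : V) :
    G.pinch v b a c d = G.pinch v a b c d := by
  ext x y
  simp only [pinch_adj, Sym2.eq_swap (a := b) (b := a)]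
  tauto

theorem pinch_swap_pairs (G : SimpleGraph V) (v a b c d : V) :
    G.pinch v c d a b = G.pinch v a b c d := by
  ext x y
  simp only [pinch_adj]
  tauto

theorem ncard_neighborSet_pinch_left {G : SimpleGraph V} {v a b c d : V}
    (hv : ∀ x, ¬ G.Adj x v) (hva : v ≠ a) (hab : G.Adj a b) (hac : a ≠ c) (had : a ≠ d) :
    ((G.pinch v a b c d).neighborSet a).ncard = (G.neighborSet a).ncard := by
  have h : (G.pinch v a b c d).neighborSet a = insert v (G.neighborSet a \ {b}) := by
    ext y
    have := hv a
    simp only [mem_neighborSet, pinch_adj, Set.mem_insert_iff, Set.mem_sdiff,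
      Set.mem_singleton_iff, ne_eq, Sym2.eq_iff]
    grind
  rw [h]
  exact Set.ncard_exchange (hv a) hab

theorem neighborSet_pinch_of_ne {G : SimpleGraph V} {v a b c d x : V}
    (hv : x ≠ v) (ha : x ≠ a) (hb : x ≠ b) (hc : x ≠ c) (hd : x ≠ d) :
    (G.pinch v a b c d).neighborSet x = G.neighborSet x := by
  ext y
  simp [pinch_adj, hv, ha, hb, hc, hd]

theorem ncard_neighborSet_pinch {G : SimpleGraph V} {v a b c d x : V}
    (hv : ∀ x, ¬ G.Adj x v) (hab : G.Adj a b) (hcd : G.Adj c d)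
    (hac : a ≠ c) (had : a ≠ d) (hbc : b ≠ c) (hbd : b ≠ d) (hx : x ≠ v) :
    ((G.pinch v a b c d).neighborSet x).ncard = (G.neighborSet x).ncard := by
  have hne : ∀ {y z}, G.Adj y z → v ≠ y := fun h e => hv _ (e ▸ h.symm)
  by_cases ha : x = a
  · subst ha
    exact ncard_neighborSet_pinch_left hv (hne hab) hab hac had
  by_cases hb : x = b
  · subst hb
    rw [← pinch_swap_left]
    exact ncard_neighborSet_pinch_left hv (hne hab.symm) hab.symm hbc hbd
  by_cases hc : x = c
  · subst hc
    rw [← pinch_swap_pairs]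
    exact ncard_neighborSet_pinch_left hv (hne hcd) hcd hac.symm hbc.symm
  by_cases hd : x = d
  · subst hd
    rw [← pinch_swap_pairs, ← pinch_swap_left]
    exact ncard_neighborSet_pinch_left hv (hne hcd.symm) hcd.symm had.symm hbd.symm
  rw [neighborSet_pinch_of_ne hx ha hb hc hd]

theorem ncard_neighborSet_pinch_self {G : SimpleGraph V} {v a b c d : V}
    (hv : ∀ x, ¬ G.Adj x v) (hab : G.Adj a b) (hcd : G.Adj c d)
    (hac : a ≠ c) (had : a ≠ d) (hbc : b ≠ c) (hbd : b ≠ d) :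
    ((G.pinch v a b c d).neighborSet v).ncard = 4 := by
  have hne : ∀ {y z}, G.Adj y z → v ≠ y := fun h e => hv _ (e ▸ h.symm)
  have h : (G.pinch v a b c d).neighborSet v = {a, b, c, d} := by
    ext y
    have h₁ := fun h : G.Adj v y => hv y h.symm
    have h₂ := hne hab
    have h₃ := hne hab.symm
    have h₄ := hne hcd
    have h₅ := hne hcd.symm
    simp only [mem_neighborSet, pinch_adj, Set.mem_insert_iff, Set.mem_singleton_iff]
    grind
  have h₁ := hab.ne
  have h₂ := hcd.ne
  rw [h]
  classical
  have hs : ({a, b, c, d} : Set V) = (({a, b, c, d} : Finset V) : Set V) := by simp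
  rw [hs, Set.ncard_coe_finset]
  simp [Finset.card_insert_of_notMem, *]

end SimpleGraph

theorem K6C5_adj_iff (a b : Fin 6) : K6C5.Adj a b ↔
    a ≠ b ∧ (a = 0 ∨ b = 0 ∨
      s(a, b) ∈ ({s(1, 3), s(3, 5), s(5, 2), s(2, 4), s(4, 1)} : Finset (Sym2 (Fin 6)))) := by
  simp only [K6C5, SimpleGraph.fromRel_adj]
  revert a b
  decide

/-- A graph on `{0, …, n - 1}` with degrees `(5⁴, 4ⁿ⁻⁴)` that contains `K₆ − C₅` on its first six
vertices, together with a path on five vertices that avoids the edges of this copy. -/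
theorem exists_realization_with_free_path (n : ℕ) (hn : 6 ≤ n) :
    ∃ G : SimpleGraph ℕ, (∀ x y, G.Adj x y → y < n) ∧
      (∀ x < n, (G.neighborSet x).ncard = if x < 4 then 5 else 4) ∧
      K6C5.map Fin.val ≤ G ∧
      ∃ p : Fin 5 → ℕ, Function.Injective p ∧ ∀ i : Fin 4,
        (G \ K6C5.map Fin.val).Adj (p i.castSucc) (p i.succ) := by
  induction n, hn using Nat.le_induction with
  | base =>
    let G : SimpleGraph ℕ :=
      { Adj := fun x y => x ≠ y ∧ x < 6 ∧ y < 6 ∧ ¬ (x = 4 ∧ y = 5) ∧ ¬ (x = 5 ∧ y = 4)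
        symm := ⟨by grind⟩
        loopless := ⟨by grind⟩ }
    refine ⟨G, fun x y h => h.2.2.1, ?_, ?_, fun i => ((![4, 3, 2, 1, 5] : Fin 5 → Fin 6) i : ℕ),
      ?_, ?_⟩
    · intro x hx
      have h : G.neighborSet x = ((Finset.range 6).filter fun y =>
          x ≠ y ∧ ¬ (x = 4 ∧ y = 5) ∧ ¬ (x = 5 ∧ y = 4) : Finset ℕ) := by
        ext y
        simp only [SimpleGraph.mem_neighborSet, G, Finset.coe_filter, Finset.mem_range,
          Set.mem_ofPred_eq]
        tauto
      rw [h, Set.ncard_coe_finset]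
      clear h
      revert x
      decide
    · refine (SimpleGraph.map_le_iff_le_comap Fin.valEmbedding _ _).2 ?_
      intro a b h
      rw [K6C5_adj_iff] at h
      simp only [SimpleGraph.comap_adj, Fin.valEmbedding_apply, G]
      revert a b
      decide
    · exact Fin.val_injective.comp (by decide)
    · intro i
      rw [SimpleGraph.sdiff_adj]
      refine ⟨by revert i; simp only [G]; decide, ?_⟩
      refine fun h => absurd ((SimpleGraph.map_adj_apply (f := Fin.valEmbedding)).1 h) ?_
      rw [K6C5_adj_iff]
      clear h
      revert i
      decide
  | succ n hn ih =>
    obtain ⟨G, hlt, hdeg, hle, p, hp, hadj⟩ := ih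
    have hpne : ∀ i j, i ≠ j → p i ≠ p j := fun i j h => hp.ne h
    have h0 : (G \ K6C5.map Fin.val).Adj (p 0) (p 1) := hadj 0
    have h1 : (G \ K6C5.map Fin.val).Adj (p 1) (p 2) := hadj 1
    have h2 : (G \ K6C5.map Fin.val).Adj (p 2) (p 3) := hadj 2
    have h3 : (G \ K6C5.map Fin.val).Adj (p 3) (p 4) := hadj 3
    rw [SimpleGraph.sdiff_adj] at h0 h1 h2 h3
    have hv : ∀ x, ¬ G.Adj x n := fun x h => (hlt x n h).false
    have hpn : ∀ i, p i < n := by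
      intro i
      fin_cases i
      exacts [hlt _ _ h0.1.symm, hlt _ _ h0.1, hlt _ _ h1.1, hlt _ _ h2.1, hlt _ _ h3.1]
    have hHn : ∀ x, ¬ (K6C5.map Fin.val).Adj x n := fun x h => hv x (hle h)
    refine ⟨G.pinch n (p 0) (p 1) (p 2) (p 3), ?_, ?_, ?_, ![p 4, p 3, n, p 1, p 2], ?_, ?_⟩
    · intro x y h
      have h₀ := hpn 0
      have h₁ := hpn 1
      have h₂ := hpn 2
      have h₃ := hpn 3
      have h₄ := hlt x y
      rw [SimpleGraph.pinch_adj] at h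
      grind
    · intro x hx
      have h02 := hpne 0 2 (by decide)
      have h03 := hpne 0 3 (by decide)
      have h12 := hpne 1 2 (by decide)
      have h13 := hpne 1 3 (by decide)
      by_cases hxn : x = n
      · rw [hxn, SimpleGraph.ncard_neighborSet_pinch_self hv h0.1 h2.1 h02 h03 h12 h13,
          if_neg (by omega)]
      · rw [SimpleGraph.ncard_neighborSet_pinch hv h0.1 h2.1 h02 h03 h12 h13 hxn,
          hdeg x (by omega)]
    · intro x y h
      rw [SimpleGraph.pinch_adj]
      refine Or.inl ⟨hle h, fun e => h0.2 ?_, fun e => h2.2 ?_⟩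
      all_goals rwa [← SimpleGraph.mem_edgeSet, ← e, SimpleGraph.mem_edgeSet]
    · have hpn' := fun i => (hpn i).ne
      intro i j
      fin_cases i <;> fin_cases j <;> simp [hp.eq_iff, hpn', fun i => (hpn' i).symm]
    · have hpn' := fun i => (hpn i).ne
      have hHn' : ∀ x, ¬ (K6C5.map Fin.val).Adj n x := fun x h => hHn x h.symm
      have h3' : ¬ (K6C5.map Fin.val).Adj (p 4) (p 3) := fun h => h3.2 h.symm
      intro i
      rw [SimpleGraph.sdiff_adj, SimpleGraph.pinch_adj]
      fin_cases i <;>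
        simp [hp.eq_iff, hpn', fun i => (hpn' i).symm, hHn, hHn', h1, h3.1.symm, h3']

theorem lemma27_1 (n : ℕ) (hn : 6 ≤ n)
    (heven : Even ((List.replicate 4 5 ++ List.replicate (n - 4) 4).sum)) :
    PotentiallyK6C5 (List.replicate 4 5 ++ List.replicate (n - 4) 4) := by
  obtain ⟨G, hlt, hdeg, hle, -⟩ := exists_realization_with_free_path n hn
  have hlen : (List.replicate 4 5 ++ List.replicate (n - 4) 4).length = n := by
    simp; omega
  refine ⟨G.comap Fin.val, fun i => ?_, fun a => ⟨a, by omega⟩, fun a b h => ?_, fun a b h => ?_⟩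
  · have hi : (i : ℕ) < n := i.isLt.trans_eq hlen
    have himage : Fin.val '' {j | (G.comap Fin.val).Adj i j} = G.neighborSet i := by
      ext y
      simp only [SimpleGraph.comap_adj, Set.mem_image, Set.mem_ofPred_eq,
        SimpleGraph.mem_neighborSet]
      exact ⟨by rintro ⟨j, hj, rfl⟩; exact hj,
        fun h => ⟨⟨y, (hlt _ _ h).trans_eq hlen.symm⟩, h, rfl⟩⟩
    rw [degCount, ← Set.ncard_image_of_injective _ Fin.val_injective, himage, hdeg i hi,
      List.get_eq_getElem, List.getElem_append]
    simp only [List.getElem_replicate, List.length_replicate, dite_eq_ite]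
  · simpa [Fin.ext_iff] using h
  · exact hle ((SimpleGraph.map_adj_apply (f := Fin.valEmbedding)).2 h)
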